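/- arXiv:0807.3590 — 2 statements merged into one kernel-verified Lean document; each statement's English description precedes it below -/
import Mathlib

section
/- Weak threshold for the orthant (probabilistic form). Let δ ∈ (0, 1) and ρ ∈ (0, 1). Let (k_n) and (N_n) be sequences of integers with 0 ≤ k_n < n < N_n, k_n/n → ρ and n/N_n → δ as n → ∞; for each n let A_n be a random n×N_n real matrix with an orthant-symmetric generic nullspace, and let x_0^{(n)} ∈ ℝ^{N_n} be a fixed vector with x_0^{(n)} ≥ 0 coordinatewise having exactly k_n nonzero entries. Let p_n be the probability of the event {the only x ∈ ℝ^{N_n} with x ≥ 0 coordinatewise and A_n x = A_n x_0^{(n)} is x = x_0^{(n)}}. Then p_n → 1 as n → ∞ if ρ < 2 − δ^{-1}, and p_n → 0 as n → ∞ if ρ > max(0, 2 − δ^{-1}). -/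
open MeasureTheory Filter

instance matrixMeasurableSpace {n N : ℕ} :
    MeasurableSpace (Matrix (Fin n) (Fin N) ℝ) :=
  (inferInstance : MeasurableSpace (Fin n → Fin N → ℝ))

/-- A random `n × N` real matrix (i.e. a probability measure on matrices) has an
orthant-symmetric generic nullspace when (i) its distribution is invariant under
right multiplication by any `±1` diagonal matrix, and (ii) almost surely it has
rank `n` and every nonzero kernel vector has at least `n + 1` nonzero coordinates. -/
def OrthantSymmetricGeneric {n N : ℕ}
    (μ : Measure (Matrix (Fin n) (Fin N) ℝ)) : Prop :=
  (∀ s : Fin N → ℝ, (∀ j, s j = 1 ∨ s j = -1) →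
    μ.map (fun A => A * Matrix.diagonal s) = μ) ∧
  μ {A | A.rank = n ∧ ∀ v : Fin N → ℝ, A.mulVec v = 0 → v ≠ 0 →
      n + 1 ≤ {i | v i ≠ 0}.ncard} = 1

open scoped Matrix

/-- The sign vector which is `-1` on `B` and `1` off `B`. -/
def signVec {N : ℕ} (B : Finset (Fin N)) : Fin N → ℝ := fun i => if i ∈ B then -1 else 1

lemma signVec_eq_one_or {N : ℕ} (B : Finset (Fin N)) (i : Fin N) :
    signVec B i = 1 ∨ signVec B i = -1 := by
  unfold signVec; split_ifs <;> simp

/-- Matrices with a nonzero kernel vector whose coordinates in `Z` weakly agree in sign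
with `s`. -/
def coneKernel (n : ℕ) {N : ℕ} (Z : Finset (Fin N)) (s : Fin N → ℝ) :
    Set (Matrix (Fin n) (Fin N) ℝ) :=
  {A | ∃ v : Fin N → ℝ, v ≠ 0 ∧ A *ᵥ v = 0 ∧ ∀ i ∈ Z, 0 ≤ s i * v i}

lemma preimage_coneKernel {n N : ℕ} (Z : Finset (Fin N)) {s : Fin N → ℝ}
    (hs : ∀ j, s j = 1 ∨ s j = -1) :
    (fun A : Matrix (Fin n) (Fin N) ℝ => A * Matrix.diagonal s) ⁻¹' coneKernel n Z 1 =
      coneKernel n Z s := by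
  have hss : ∀ i, s i * s i = 1 := fun i => by rcases hs i with h | h <;> simp [h]
  have hdiag : ∀ v : Fin N → ℝ, Matrix.diagonal s *ᵥ v = fun i => s i * v i := fun v => by
    ext i; exact Matrix.mulVec_diagonal s v i
  ext A
  constructor
  · rintro ⟨v, hv, hA, hpos⟩
    refine ⟨fun i => s i * v i, fun h => hv ?_, ?_, fun i hi => ?_⟩
    · ext i
      have := congrFun h i
      rcases hs i with h' | h' <;> simpa [h'] using this
    · rwa [← Matrix.mulVec_mulVec, hdiag] at hA
    · rw [← mul_assoc, hss]; exact hpos i hi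
  · rintro ⟨v, hv, hA, hpos⟩
    refine ⟨fun i => s i * v i, fun h => hv ?_, ?_, fun i hi => ?_⟩
    · ext i
      have := congrFun h i
      rcases hs i with h' | h' <;> simpa [h'] using this
    · rw [← Matrix.mulVec_mulVec, hdiag]
      simpa [← mul_assoc, hss] using hA
    · simpa using hpos i hi

lemma isClosed_coneKernel {n N : ℕ} (Z : Finset (Fin N)) (s : Fin N → ℝ) :
    IsClosed (coneKernel n Z s) := by
  have hC : IsClosed {q : Matrix (Fin n) (Fin N) ℝ × Metric.sphere (0 : Fin N → ℝ) 1 |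
      q.1 *ᵥ (q.2 : Fin N → ℝ) = 0 ∧ ∀ i ∈ Z, 0 ≤ s i * (q.2 : Fin N → ℝ) i} := by
    refine IsClosed.and (isClosed_eq ?_ continuous_const) ?_
    · exact Continuous.matrix_mulVec continuous_fst (continuous_subtype_val.comp continuous_snd)
    · simp only [Set.ofPred_forall]
      refine isClosed_iInter fun i => isClosed_iInter fun _ => ?_
      refine isClosed_le continuous_const (continuous_const.mul ?_)
      exact (continuous_apply i).comp (continuous_subtype_val.comp continuous_snd)
  convert isClosedMap_fst_of_compactSpace _ hC using 1
  ext A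
  constructor
  · rintro ⟨v, hv, hA, hpos⟩
    refine ⟨⟨A, ⟨‖v‖⁻¹ • v, ?_⟩⟩, ⟨?_, fun i hi => ?_⟩, rfl⟩
    · simp [norm_smul, hv]
    · simp [Matrix.mulVec_smul, hA]
    · have := mul_nonneg (inv_nonneg.2 (norm_nonneg v)) (hpos i hi)
      simp only [Pi.smul_apply, smul_eq_mul]
      linarith
  · rintro ⟨⟨A', v⟩, ⟨hA, hpos⟩, rfl⟩
    exact ⟨v, fun h => by simpa [h] using v.2, hA, hpos⟩

lemma measurableSet_coneKernel {n N : ℕ} (Z : Finset (Fin N)) (s : Fin N → ℝ) :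
    MeasurableSet (coneKernel n Z s) := by
  have h : @MeasurableSet (Fin n → Fin N → ℝ) _ (coneKernel n Z s) :=
    IsClosed.measurableSet (α := Fin n → Fin N → ℝ) (isClosed_coneKernel Z s)
  exact h

lemma measurable_mul_diagonal {n N : ℕ} (s : Fin N → ℝ) :
    Measurable (fun A : Matrix (Fin n) (Fin N) ℝ => A * Matrix.diagonal s) := by
  have h : Measurable (fun (A : Fin n → Fin N → ℝ) i j => A i j * s j) := by fun_prop
  have heq : (fun A : Matrix (Fin n) (Fin N) ℝ => A * Matrix.diagonal s) =
      fun A i j => A i j * s j := by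
    ext A i j
    exact Matrix.mul_diagonal s A i j
  rw [heq]
  exact h

lemma OrthantSymmetricGeneric.measure_coneKernel {n N : ℕ}
    {μ : Measure (Matrix (Fin n) (Fin N) ℝ)} (hμ : OrthantSymmetricGeneric μ)
    (Z : Finset (Fin N)) {s : Fin N → ℝ} (hs : ∀ j, s j = 1 ∨ s j = -1) :
    μ (coneKernel n Z s) = μ (coneKernel n Z 1) := by
  rw [← preimage_coneKernel Z hs, ← Measure.map_apply (measurable_mul_diagonal s)
    (measurableSet_coneKernel Z 1), hμ.1 s hs]

/-- If every point of a set of outer measure one lies in at most `C` of the equiprobable events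
`E b`, `b ∈ P`, then the common probability `q` satisfies `#P * q ≤ C`. -/
lemma card_mul_le_of_measure_eq {Ω ι : Type*} [MeasurableSpace Ω] {μ : Measure Ω}
    [IsProbabilityMeasure μ] (P : Finset ι) {E : ι → Set Ω} {q : ENNReal} {C : ℕ} {G : Set Ω}
    (hE : ∀ b ∈ P, MeasurableSet (E b)) (hq : ∀ b ∈ P, μ (E b) = q) (hG : μ G = 1)
    (hC : ∀ ω ∈ G, {b ∈ (P : Set ι) | ω ∈ E b}.ncard ≤ C) :
    (P.card : ENNReal) * q ≤ C := by
  classical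
  have hmeas : ∀ b ∈ P, Measurable ((E b).indicator (1 : Ω → ENNReal)) := fun b hb =>
    measurable_one.indicator (hE b hb)
  have hmem : {ω | ∑ b ∈ P, (E b).indicator (1 : Ω → ENNReal) ω ≤ C} ∈ ae μ := by
    rw [mem_ae_iff_prob_eq_one
      (measurableSet_le (Finset.measurable_fun_sum P hmeas) measurable_const)]
    refine le_antisymm prob_le_one (hG.symm.le.trans (measure_mono fun ω hω => ?_))
    have h := hC ω hω
    have hset : {b ∈ (P : Set ι) | ω ∈ E b} = ↑(P.filter fun b => ω ∈ E b) := by ext; simp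
    rw [hset, Set.ncard_coe_finset] at h
    simpa [Set.indicator_apply] using h
  calc (P.card : ENNReal) * q = ∑ b ∈ P, μ (E b) := by simp [Finset.sum_congr rfl hq]
    _ = ∫⁻ ω, ∑ b ∈ P, (E b).indicator 1 ω ∂μ := by
        rw [lintegral_finsetSum _ hmeas]
        exact Finset.sum_congr rfl fun b hb => (lintegral_indicator_one (hE b hb)).symm
    _ ≤ ∫⁻ _, (C : ENNReal) ∂μ := lintegral_mono_ae hmem
    _ = C := by simp

lemma sum_powerset_sq {ι : Type*} [DecidableEq ι] (Z : Finset ι) :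
    ∑ T ∈ Z.powerset, ((Z.card : ℝ) - 2 * T.card) ^ 2 = (Z.card : ℝ) * 2 ^ Z.card := by
  induction Z using Finset.induction_on with
  | empty => simp
  | insert a Z ha ih =>
    rw [Finset.sum_powerset_insert ha, ← Finset.sum_add_distrib, Finset.card_insert_of_notMem ha]
    have h : ∀ T ∈ Z.powerset, (((Z.card + 1 : ℕ) : ℝ) - 2 * T.card) ^ 2 +
        (((Z.card + 1 : ℕ) : ℝ) - 2 * (insert a T).card) ^ 2 =
        2 * ((Z.card : ℝ) - 2 * T.card) ^ 2 + 2 := fun T hT => by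
      rw [Finset.card_insert_of_notMem fun h => ha (Finset.mem_powerset.1 hT h)]
      push_cast; ring
    rw [Finset.sum_congr rfl h, Finset.sum_add_distrib, ← Finset.mul_sum, ih]
    simp [Finset.card_powerset]
    ring

/-- Chebyshev's inequality for the size of a random subset. -/
lemma card_filter_powerset_mul_sq_le {ι : Type*} [DecidableEq ι] (Z : Finset ι) (r : ℕ)
    (hr : (2 * r : ℝ) ≤ Z.card) :
    (({T ∈ Z.powerset | T.card ≤ r} : Finset _).card : ℝ) * ((Z.card : ℝ) - 2 * r) ^ 2 ≤
      Z.card * 2 ^ Z.card := by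
  rw [← sum_powerset_sq, ← nsmul_eq_mul]
  refine (Finset.card_nsmul_le_sum _ (fun T => ((Z.card : ℝ) - 2 * T.card) ^ 2) _
    fun T hT => ?_).trans
    (Finset.sum_le_sum_of_subset_of_nonneg (Finset.filter_subset _ _) fun _ _ _ => sq_nonneg _)
  have : (T.card : ℝ) ≤ r := by exact_mod_cast (Finset.mem_filter.1 hT).2
  exact pow_le_pow_left₀ (by linarith) (by linarith) 2

/-- Sauer–Shelah for a family of subsets of `Z`. -/
lemma ncard_le_of_shatters {ι : Type*} [DecidableEq ι] (Z : Finset ι) (r : ℕ)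
    (F : Finset ι → Prop)
    (h : ∀ T ⊆ Z, (∀ t ⊆ T, ∃ B ⊆ Z, F B ∧ T ∩ B = t) → T.card ≤ r) :
    {B ∈ (Z.powerset : Set (Finset ι)) | F B}.ncard ≤
      ({T ∈ Z.powerset | T.card ≤ r} : Finset _).card := by
  classical
  have hset : {B ∈ (Z.powerset : Set (Finset ι)) | F B} = ↑(Z.powerset.filter F) := by ext; simp
  rw [hset, Set.ncard_coe_finset]
  refine (Finset.card_le_card_shatterer _).trans (Finset.card_le_card fun T hT => ?_)
  rw [Finset.mem_shatterer] at hT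
  have hT' : ∀ t ⊆ T, ∃ B ⊆ Z, F B ∧ T ∩ B = t := fun t ht => by
    obtain ⟨B, hB, hBt⟩ := hT ht
    rw [Finset.mem_filter, Finset.mem_powerset] at hB
    exact ⟨B, hB.1, hB.2, hBt⟩
  obtain ⟨B, hB, -, hTB⟩ := hT' T subset_rfl
  have hTZ : T ⊆ Z := (Finset.inter_eq_left.1 hTB).trans hB
  simpa using ⟨hTZ, h T hTZ hT'⟩

/-- The linear map sending `v` to `A v` together with the coordinates of `v` off `W`. -/
def mulVecProdRestrict {n N : ℕ} (A : Matrix (Fin n) (Fin N) ℝ) (W : Finset (Fin N)) :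
    (Fin N → ℝ) →ₗ[ℝ] (Fin n → ℝ) × ({i // i ∈ Wᶜ} → ℝ) :=
  A.mulVecLin.prod (LinearMap.funLeft ℝ ℝ Subtype.val)

lemma mulVecProdRestrict_eq_iff {n N : ℕ} {A : Matrix (Fin n) (Fin N) ℝ} {W : Finset (Fin N)}
    {v : Fin N → ℝ} {y : Fin n → ℝ} :
    mulVecProdRestrict A W v = (y, 0) ↔ A *ᵥ v = y ∧ ∀ i ∉ W, v i = 0 := by
  simp [mulVecProdRestrict, Prod.ext_iff, funext_iff, LinearMap.funLeft]

lemma finrank_codomain_mulVecProdRestrict {n N : ℕ} (W : Finset (Fin N)) :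
    Module.finrank ℝ ((Fin n → ℝ) × ({i // i ∈ Wᶜ} → ℝ)) = n + (N - W.card) := by
  rw [Module.finrank_prod, Module.finrank_fin_fun, Module.finrank_fintype_fun_eq_card,
    Fintype.card_coe, Finset.card_compl, Fintype.card_fin]

lemma exists_kernel_supported_of_lt_card {n N : ℕ} (A : Matrix (Fin n) (Fin N) ℝ)
    (W : Finset (Fin N)) (hW : n < W.card) :
    ∃ v : Fin N → ℝ, v ≠ 0 ∧ A *ᵥ v = 0 ∧ ∀ i ∉ W, v i = 0 := by
  have hWN : W.card ≤ N := by simpa using W.card_le_univ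
  have hlt : Module.finrank ℝ ((Fin n → ℝ) × ({i // i ∈ Wᶜ} → ℝ)) <
      Module.finrank ℝ (Fin N → ℝ) := by
    rw [finrank_codomain_mulVecProdRestrict, Module.finrank_fin_fun]; omega
  obtain ⟨v, hv, hv0⟩ := (Submodule.ne_bot_iff _).1
    (LinearMap.ker_ne_bot_of_finrank_lt (f := mulVecProdRestrict A W) hlt)
  exact ⟨v, hv0, mulVecProdRestrict_eq_iff.1 (LinearMap.mem_ker.1 hv)⟩

lemma exists_kernel_supported_of_vecMul_eq_zero {n N : ℕ} (A : Matrix (Fin n) (Fin N) ℝ)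
    (W : Finset (Fin N)) (hW : W.card = n) {y : Fin n → ℝ} (hy : y ≠ 0)
    (hyW : ∀ i ∈ W, (y ᵥ* A) i = 0) :
    ∃ v : Fin N → ℝ, v ≠ 0 ∧ A *ᵥ v = 0 ∧ ∀ i ∉ W, v i = 0 := by
  have hWN : W.card ≤ N := by simpa using W.card_le_univ
  have heq : Module.finrank ℝ (Fin N → ℝ) =
      Module.finrank ℝ ((Fin n → ℝ) × ({i // i ∈ Wᶜ} → ℝ)) := by
    rw [finrank_codomain_mulVecProdRestrict, Module.finrank_fin_fun]; omega
  by_contra! hcon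
  have hinj : Function.Injective (mulVecProdRestrict A W) := by
    rw [injective_iff_map_eq_zero]
    intro v hv
    obtain ⟨h1, h2⟩ := mulVecProdRestrict_eq_iff.1 hv
    by_contra hv0
    obtain ⟨i, hi, hvi⟩ := hcon v hv0 h1
    exact hvi (h2 i hi)
  obtain ⟨v, hv⟩ :=
    (LinearMap.injective_iff_surjective_of_finrank_eq_finrank heq).1 hinj (y, 0)
  obtain ⟨h1, h2⟩ := mulVecProdRestrict_eq_iff.1 hv
  refine hy (dotProduct_self_eq_zero.1 ?_)
  nth_rw 2 [← h1]
  rw [Matrix.dotProduct_mulVec]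
  refine Finset.sum_eq_zero fun i _ => ?_
  by_cases hi : i ∈ W
  · rw [hyW i hi, zero_mul]
  · rw [h2 i hi, mul_zero]

lemma exists_vecMul_eq_zero_on {n N : ℕ} (A : Matrix (Fin n) (Fin N) ℝ)
    (W : Finset (Fin N)) (hW : W.card < n) :
    ∃ y : Fin n → ℝ, y ≠ 0 ∧ ∀ i ∈ W, (y ᵥ* A) i = 0 := by
  have hlt : Module.finrank ℝ ({i // i ∈ W} → ℝ) < Module.finrank ℝ (Fin n → ℝ) := by
    rw [Module.finrank_fin_fun, Module.finrank_fintype_fun_eq_card, Fintype.card_coe]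
    exact hW
  obtain ⟨y, hy, hy0⟩ := (Submodule.ne_bot_iff _).1 (LinearMap.ker_ne_bot_of_finrank_lt
    (f := (LinearMap.funLeft ℝ ℝ (Subtype.val : {i // i ∈ W} → Fin N)).comp A.vecMulLinear) hlt)
  exact ⟨y, hy0, fun i hi => congrFun (LinearMap.mem_ker.1 hy) ⟨i, hi⟩⟩

lemma ncard_mem_coneKernel_le {n N : ℕ} (hnN : n ≤ N) {A : Matrix (Fin n) (Fin N) ℝ}
    (hA : ∀ v : Fin N → ℝ, A *ᵥ v = 0 → v ≠ 0 → n + 1 ≤ {i | v i ≠ 0}.ncard)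
    (Z : Finset (Fin N)) :
    {B ∈ (Z.powerset : Set (Finset (Fin N))) | A ∈ coneKernel n Z (signVec B)}.ncard ≤
      ({T ∈ Z.powerset | T.card ≤ N - n} : Finset _).card := by
  have hcard : ∀ (v : Fin N → ℝ) (W : Finset (Fin N)), W.card ≤ n → A *ᵥ v = 0 →
      (∀ i ∉ W, v i = 0) → v = 0 := fun v W hW hv hvW => by
    by_contra hv0
    have h1 := hA v hv hv0
    have h2 : {i | v i ≠ 0}.ncard ≤ W.card := by
      rw [← Set.ncard_coe_finset]
      exact Set.ncard_le_ncard (fun i hi => by_contra fun h => hi (hvW i h)) W.finite_toSet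
    omega
  refine ncard_le_of_shatters Z _ _ fun T hTZ hT => ?_
  by_contra! hlt
  have hTn : Tᶜ.card < n := by
    have hTN : T.card ≤ N := by simpa using T.card_le_univ
    rw [Finset.card_compl, Fintype.card_fin]; omega
  obtain ⟨y, hy, hyT⟩ := exists_vecMul_eq_zero_on A Tᶜ hTn
  set c := y ᵥ* A
  have hc : (Finset.univ.filter fun i => c i = 0).card < n := by
    by_contra! hle
    obtain ⟨W, hWs, hW⟩ := Finset.exists_subset_card_eq hle
    obtain ⟨v, hv0, hv, hvW⟩ := exists_kernel_supported_of_vecMul_eq_zero A W hW hy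
      fun i hi => (Finset.mem_filter.1 (hWs hi)).2
    exact hv0 (hcard v W hW.le hv hvW)
  obtain ⟨B, -, ⟨v, hv0, hv, hpos⟩, hB⟩ :=
    hT (T.filter fun i => c i < 0) (Finset.filter_subset _ _)
  have hnonneg : ∀ i ∈ Finset.univ, 0 ≤ c i * v i := fun i _ => by
    by_cases hi : i ∈ T
    · have hs := hpos i (hTZ hi)
      have hiB : i ∈ B ↔ c i < 0 := by
        have := Finset.ext_iff.1 hB i
        simpa [hi] using this
      by_cases hci : c i < 0
      · rw [signVec, if_pos (hiB.2 hci)] at hs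
        nlinarith
      · rw [signVec, if_neg (mt hiB.1 hci)] at hs
        exact mul_nonneg (not_lt.1 hci) (by linarith)
    · rw [hyT i (Finset.mem_compl.2 hi), zero_mul]
  have hsum : ∑ i, c i * v i = 0 := by
    change c ⬝ᵥ v = 0
    rw [← Matrix.dotProduct_mulVec, hv, dotProduct_zero]
  refine hv0 (hcard v _ hc.le hv fun i hi => ?_)
  have := (Finset.sum_eq_zero_iff_of_nonneg hnonneg).1 hsum i (Finset.mem_univ i)
  exact (mul_eq_zero.1 this).resolve_left (by simpa using hi)

lemma ncard_mem_compl_coneKernel_le {n N : ℕ} (A : Matrix (Fin n) (Fin N) ℝ)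
    (Z : Finset (Fin N)) :
    {B ∈ (Z.powerset : Set (Finset (Fin N))) | A ∈ (coneKernel n Z (signVec B))ᶜ}.ncard ≤
      ({T ∈ Z.powerset | T.card ≤ n - Zᶜ.card} : Finset _).card := by
  refine ncard_le_of_shatters Z _ _ fun T hTZ hT => ?_
  by_contra! hlt
  have hdisj : Disjoint T Zᶜ := disjoint_compl_right.mono_left hTZ
  obtain ⟨v, hv0, hv, hvW⟩ := exists_kernel_supported_of_lt_card A (T ∪ Zᶜ)
    (by rw [Finset.card_union_of_disjoint hdisj]; omega)
  obtain ⟨B, -, hBA, hB⟩ := hT (T.filter fun i => v i < 0) (Finset.filter_subset _ _)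
  refine hBA ⟨v, hv0, hv, fun i hiZ => ?_⟩
  by_cases hi : i ∈ T
  · have hiB : i ∈ B ↔ v i < 0 := by
      have := Finset.ext_iff.1 hB i
      simpa [hi] using this
    by_cases hvi : v i < 0
    · rw [signVec, if_pos (hiB.2 hvi)]; linarith
    · rw [signVec, if_neg (mt hiB.1 hvi)]; linarith
  · rw [hvW i (by simp [hi, hiZ]), mul_zero]

lemma uniqueness_eq_compl_coneKernel {n N : ℕ} {x₀ : Fin N → ℝ} (hx₀ : ∀ i, 0 ≤ x₀ i) :
    {A : Matrix (Fin n) (Fin N) ℝ | ∀ x : Fin N → ℝ, (∀ i, 0 ≤ x i) →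
      A *ᵥ x = A *ᵥ x₀ → x = x₀} = (coneKernel n (Finset.univ.filter fun i => x₀ i = 0) 1)ᶜ := by
  ext A
  simp only [Set.mem_compl_iff, Set.mem_ofPred_eq]
  constructor
  · rintro h ⟨v, hv0, hv, hpos⟩
    have hev : ∀ᶠ t : ℝ in nhdsWithin 0 (Set.Ioi 0), ∀ i, 0 ≤ x₀ i + t * v i := by
      rw [eventually_all]
      intro i
      rcases (hx₀ i).eq_or_lt with hi | hi
      · filter_upwards [self_mem_nhdsWithin] with t ht
        have := hpos i (by simp [← hi])
        rw [← hi, zero_add]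
        exact mul_nonneg (le_of_lt ht) (by simpa using this)
      · have hcont : Continuous fun t : ℝ => x₀ i + t * v i := by fun_prop
        have := hcont.tendsto 0
        rw [zero_mul, add_zero] at this
        exact (this.mono_left nhdsWithin_le_nhds).eventually (eventually_ge_nhds hi)
    obtain ⟨t, ht, ht0⟩ := (hev.and self_mem_nhdsWithin).exists
    have := h (x₀ + t • v) ht (by rw [Matrix.mulVec_add, Matrix.mulVec_smul, hv]; simp)
    rw [add_eq_left, smul_eq_zero] at this
    exact this.elim (ne_of_gt ht0) hv0
  · intro h x hx hAx
    by_contra hne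
    refine h ⟨x - x₀, sub_ne_zero.2 hne, by rw [Matrix.mulVec_sub, hAx, sub_self], fun i hi => ?_⟩
    simpa [(Finset.mem_filter.1 hi).2] using hx i

lemma toReal_le_of_card_powerset_mul_le {ι : Type*} [DecidableEq ι] {Z : Finset ι} {r : ℕ}
    {q : ENNReal} (hr : (2 * r : ℝ) < Z.card)
    (hq : (Z.powerset.card : ENNReal) * q ≤
      (({T ∈ Z.powerset | T.card ≤ r} : Finset _).card : ℕ)) :
    q.toReal ≤ Z.card / ((Z.card : ℝ) - 2 * r) ^ 2 := by
  have h1 := ENNReal.toReal_mono (ENNReal.natCast_ne_top _) hq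
  rw [ENNReal.toReal_mul, ENNReal.toReal_natCast, ENNReal.toReal_natCast,
    Finset.card_powerset] at h1
  push_cast at h1
  have h2 := card_filter_powerset_mul_sq_le Z r hr.le
  have hD : 0 < ((Z.card : ℝ) - 2 * r) ^ 2 := pow_pos (by linarith) 2
  rw [le_div_iff₀ hD]
  have h3 := (mul_le_mul_of_nonneg_right h1 hD.le).trans h2
  have h4 : (0 : ℝ) < 2 ^ Z.card := by positivity
  rw [mul_assoc, mul_comm (Z.card : ℝ)] at h3
  exact le_of_mul_le_mul_left h3 h4

section Bounds

variable {n N : ℕ} {μ : Measure (Matrix (Fin n) (Fin N) ℝ)} [IsProbabilityMeasure μ]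

lemma OrthantSymmetricGeneric.measure_coneKernel_le (hμ : OrthantSymmetricGeneric μ)
    (hnN : n ≤ N) (Z : Finset (Fin N)) (hZ : 2 * ((N : ℝ) - n) < Z.card) :
    (μ (coneKernel n Z 1)).toReal ≤ Z.card / ((Z.card : ℝ) - 2 * ((N : ℝ) - n)) ^ 2 := by
  rw [← Nat.cast_sub hnN] at hZ ⊢
  exact toReal_le_of_card_powerset_mul_le hZ (card_mul_le_of_measure_eq Z.powerset
    (fun B _ => measurableSet_coneKernel Z (signVec B))
    (fun B _ => hμ.measure_coneKernel Z (signVec_eq_one_or B)) hμ.2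
    fun A hA => ncard_mem_coneKernel_le hnN hA.2 Z)

lemma OrthantSymmetricGeneric.measure_compl_coneKernel_le (hμ : OrthantSymmetricGeneric μ)
    (Z : Finset (Fin N)) (hn : Zᶜ.card ≤ n) (hZ : 2 * ((n : ℝ) - Zᶜ.card) < Z.card) :
    (μ (coneKernel n Z 1)ᶜ).toReal ≤
      Z.card / ((Z.card : ℝ) - 2 * ((n : ℝ) - Zᶜ.card)) ^ 2 := by
  rw [← Nat.cast_sub hn] at hZ ⊢
  refine toReal_le_of_card_powerset_mul_le hZ (card_mul_le_of_measure_eq (μ := μ) Z.powerset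
    (fun B _ => (measurableSet_coneKernel Z (signVec B)).compl)
    (fun B _ => ?_) measure_univ fun A _ => ncard_mem_compl_coneKernel_le A Z)
  rw [prob_compl_eq_one_sub (measurableSet_coneKernel _ _),
    prob_compl_eq_one_sub (measurableSet_coneKernel _ _),
    hμ.measure_coneKernel Z (signVec_eq_one_or B)]

end Bounds

lemma tendsto_div_sq_zero {M D : ℕ → ℝ} {a c : ℝ} (hc : c ≠ 0)
    (hM : Tendsto (fun n : ℕ => M n / n) atTop (nhds a))
    (hD : Tendsto (fun n : ℕ => D n / n) atTop (nhds c)) :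
    Tendsto (fun n : ℕ => M n / D n ^ 2) atTop (nhds 0) := by
  have h := (hM.div (hD.pow 2) (pow_ne_zero 2 hc)).mul (tendsto_inv_atTop_nhds_zero_nat (𝕜 := ℝ))
  rw [mul_zero] at h
  refine h.congr' ?_
  filter_upwards [eventually_gt_atTop 0] with n hn
  have hn' : (n : ℝ) ≠ 0 := by exact_mod_cast hn.ne'
  simp only [Pi.div_apply]
  by_cases hDn : D n = 0
  · simp [hDn]
  · field_simp

lemma eventually_pos_of_tendsto_div {D : ℕ → ℝ} {c : ℝ} (hc : 0 < c)
    (hD : Tendsto (fun n : ℕ => D n / n) atTop (nhds c)) : ∀ᶠ n in atTop, 0 < D n := by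
  filter_upwards [hD.eventually (eventually_gt_nhds hc), eventually_gt_atTop 0] with n h hn
  exact (div_pos_iff_of_pos_right (by exact_mod_cast hn)).1 h

/-- **Weak threshold for the orthant (probabilistic form).** Let `p_n` be the
probability that a fixed nonnegative vector with exactly `k_n` nonzeros is the
unique nonnegative solution of the corresponding underdetermined system. Then
`p_n → 1` if `ρ < 2 - δ⁻¹`, and `p_n → 0` if `ρ > max 0 (2 - δ⁻¹)`. -/
theorem weak_threshold_orthant (δ ρ : ℝ)
    (hδ0 : 0 < δ) (hδ1 : δ < 1) (hρ0 : 0 < ρ) (hρ1 : ρ < 1)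
    (k Nn : ℕ → ℕ)
    (hseq : ∀ n : ℕ, 1 ≤ n → k n < n ∧ n < Nn n)
    (hk : Tendsto (fun n : ℕ => (k n : ℝ) / n) atTop (nhds ρ))
    (hN : Tendsto (fun n : ℕ => (n : ℝ) / Nn n) atTop (nhds δ))
    (μ : (n : ℕ) → Measure (Matrix (Fin n) (Fin (Nn n)) ℝ))
    [∀ n, IsProbabilityMeasure (μ n)]
    (hμ : ∀ n : ℕ, 1 ≤ n → OrthantSymmetricGeneric (μ n))
    (x0 : (n : ℕ) → Fin (Nn n) → ℝ)
    (hx0 : ∀ n : ℕ, 1 ≤ n →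
      (∀ i, 0 ≤ x0 n i) ∧ {i | x0 n i ≠ 0}.ncard = k n) :
    (ρ < 2 - δ⁻¹ →
      Tendsto (fun n : ℕ =>
          (μ n {A | ∀ x : Fin (Nn n) → ℝ, (∀ i, 0 ≤ x i) →
            A.mulVec x = A.mulVec (x0 n) → x = x0 n}).toReal)
        atTop (nhds 1)) ∧
    (max 0 (2 - δ⁻¹) < ρ →
      Tendsto (fun n : ℕ =>
          (μ n {A | ∀ x : Fin (Nn n) → ℝ, (∀ i, 0 ≤ x i) →
            A.mulVec x = A.mulVec (x0 n) → x = x0 n}).toReal)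
        atTop (nhds 0)) := by
  set Z : (n : ℕ) → Finset (Fin (Nn n)) := fun n => Finset.univ.filter fun i => x0 n i = 0
    with hZdef
  have hZc : ∀ n, 1 ≤ n → (Z n)ᶜ.card = k n := fun n hn => by
    rw [← (hx0 n hn).2, ← Set.ncard_coe_finset]
    congr 1
    ext i
    simp [hZdef]
  have hZcard : ∀ n, 1 ≤ n → ((Z n).card : ℝ) = Nn n - k n := fun n hn => by
    have h := Finset.card_add_card_compl (Z n)
    rw [hZc n hn, Fintype.card_fin] at h
    rw [eq_sub_iff_add_eq]
    exact_mod_cast h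
  have hevent : ∀ n, 1 ≤ n → {A : Matrix (Fin n) (Fin (Nn n)) ℝ | ∀ x : Fin (Nn n) → ℝ,
      (∀ i, 0 ≤ x i) → A.mulVec x = A.mulVec (x0 n) → x = x0 n} = (coneKernel n (Z n) 1)ᶜ :=
    fun n hn => uniqueness_eq_compl_coneKernel (hx0 n hn).1
  have hN' : Tendsto (fun n : ℕ => (Nn n : ℝ) / n) atTop (nhds δ⁻¹) := by
    simpa using hN.inv₀ hδ0.ne'
  have hM : Tendsto (fun n : ℕ => ((Nn n : ℝ) - k n) / n) atTop (nhds (δ⁻¹ - ρ)) := by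
    simpa only [sub_div] using hN'.sub hk
  have hD : Tendsto (fun n : ℕ => ((Nn n : ℝ) + k n - 2 * n) / n) atTop
      (nhds (δ⁻¹ + ρ - 2)) := by
    refine ((hN'.add hk).sub_const 2).congr' ?_
    filter_upwards [eventually_gt_atTop 0] with n hn
    have hn' : (n : ℝ) ≠ 0 := by exact_mod_cast hn.ne'
    field_simp
  constructor
  · intro hρ
    have hD' : Tendsto (fun n : ℕ => (2 * (n : ℝ) - Nn n - k n) / n) atTop
        (nhds (2 - δ⁻¹ - ρ)) := by
      convert hD.neg using 2 <;> ring
    have hc : 0 < 2 - δ⁻¹ - ρ := by linarith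
    have hcone : Tendsto (fun n => (μ n (coneKernel n (Z n) 1)).toReal) atTop (nhds 0) := by
      refine squeeze_zero' (Eventually.of_forall fun _ => ENNReal.toReal_nonneg) ?_
        (tendsto_div_sq_zero hc.ne' hM hD')
      filter_upwards [eventually_pos_of_tendsto_div hc hD', eventually_ge_atTop 1] with n hpos hn
      have h := (hμ n hn).measure_coneKernel_le (hseq n hn).2.le (Z n)
        (by rw [hZcard n hn]; linarith)
      rw [hZcard n hn] at h
      convert h using 3
      ring
    have h1 := hcone.const_sub 1
    rw [sub_zero] at h1
    refine h1.congr' ?_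
    filter_upwards [eventually_ge_atTop 1] with n hn
    rw [hevent n hn, prob_compl_eq_one_sub (measurableSet_coneKernel _ _),
      ENNReal.toReal_sub_of_le prob_le_one ENNReal.one_ne_top, ENNReal.toReal_one]
  · intro hρ
    have hc : 0 < δ⁻¹ + ρ - 2 := by linarith [le_max_right 0 (2 - δ⁻¹)]
    refine squeeze_zero' (Eventually.of_forall fun _ => ENNReal.toReal_nonneg) ?_
      (tendsto_div_sq_zero hc.ne' hM hD)
    filter_upwards [eventually_pos_of_tendsto_div hc hD, eventually_ge_atTop 1] with n hpos hn
    have h := (hμ n hn).measure_compl_coneKernel_le (Z n)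
      (by rw [hZc n hn]; exact (hseq n hn).1.le) (by rw [hZcard n hn, hZc n hn]; linarith)
    rw [hZcard n hn, hZc n hn] at h
    rw [hevent n hn]
    convert h using 3
    ring
end

section
/- Weak threshold for the hypercube (probabilistic form). Let δ ∈ (0, 1) and ρ ∈ (0, 1). Let (k_n) and (N_n) be sequences of integers with 0 ≤ k_n < n < N_n, k_n/n → ρ and n/N_n → δ as n → ∞; for each n let A_n be a random n×N_n real matrix with an orthant-symmetric generic nullspace, and let x_0^{(n)} ∈ ℝ^{N_n} be a fixed vector with 0 ≤ x_0^{(n)}(i) ≤ 1 for all i, having exactly k_n entries strictly between 0 and 1. Let p_n be the probability of the event {the only x ∈ ℝ^{N_n} with 0 ≤ x(i) ≤ 1 for all i and A_n x = A_n x_0^{(n)} is x = x_0^{(n)}}. Then p_n → 1 as n → ∞ if ρ < 2 − δ^{-1}, and p_n → 0 as n → ∞ if ρ > max(0, 2 − δ^{-1}). -/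
open MeasureTheory Filter

/-- Matrices whose kernel contains a nonzero vector that is nonnegative on `S ∩ t` and
nonpositive on `S \ t`. -/
def kernelMeetsOrthant (n : ℕ) {N : ℕ} (S t : Finset (Fin N)) :
    Set (Matrix (Fin n) (Fin N) ℝ) :=
  {A | ∃ v : Fin N → ℝ, v ≠ 0 ∧ A.mulVec v = 0 ∧
    ∀ i ∈ S, (i ∈ t → 0 ≤ v i) ∧ (i ∉ t → v i ≤ 0)}

/-- Matrices all of whose nonzero kernel vectors have more than `n` nonzero coordinates. -/
def genericKernel (n N : ℕ) : Set (Matrix (Fin n) (Fin N) ℝ) :=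
  {A | ∀ v : Fin N → ℝ, A.mulVec v = 0 → v ≠ 0 → n + 1 ≤ {i | v i ≠ 0}.ncard}

lemma Finset.card_le_sum_choose_of_shatters {α : Type*} [DecidableEq α]
    {𝒜 : Finset (Finset α)} {S : Finset α} {m : ℕ} (hS : 𝒜 ⊆ S.powerset)
    (h : ∀ U ⊆ S, 𝒜.Shatters U → U.card ≤ m) :
    𝒜.card ≤ ∑ l ∈ Finset.range (m + 1), S.card.choose l := by
  have hsub : 𝒜.shatterer ⊆ (Finset.range (m + 1)).biUnion fun l => S.powersetCard l := by
    intro U hU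
    rw [Finset.mem_shatterer] at hU
    obtain ⟨t, ht, hUt⟩ := hU.exists_superset
    have hUS : U ⊆ S := hUt.trans (Finset.mem_powerset.1 (hS ht))
    simp only [Finset.mem_biUnion, Finset.mem_range, Finset.mem_powersetCard]
    exact ⟨U.card, Nat.lt_succ_of_le (h U hUS hU), hUS, rfl⟩
  calc 𝒜.card ≤ 𝒜.shatterer.card := Finset.card_le_card_shatterer 𝒜
    _ ≤ _ := Finset.card_le_card hsub
    _ ≤ ∑ l ∈ Finset.range (m + 1), (S.powersetCard l).card := Finset.card_biUnion_le
    _ = _ := by simp only [Finset.card_powersetCard]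

/-- In a matrix with generic kernel any `n` columns span. -/
lemma card_vecMul_eq_zero_lt {n N : ℕ} {A : Matrix (Fin n) (Fin N) ℝ}
    (hA : A ∈ genericKernel n N) {y : Fin n → ℝ} (hy : y ≠ 0) :
    {j | A.vecMul y j = 0}.ncard < n := by
  classical
  by_contra! hcard
  rw [Set.ncard_eq_toFinset_card'] at hcard
  obtain ⟨T, hT, hTn⟩ := Finset.exists_subset_card_eq hcard
  let f : Fin n ↪o Fin N := T.orderEmbOfFin hTn
  have hdet : (A.submatrix id f).det = 0 := by
    rw [← Matrix.exists_vecMul_eq_zero_iff]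
    refine ⟨y, hy, ?_⟩
    ext j
    have := hT (T.orderEmbOfFin_mem hTn j)
    exact (Set.mem_toFinset.1 this :)
  obtain ⟨w, hw, hAw⟩ := Matrix.exists_mulVec_eq_zero_iff.2 hdet
  let v : Fin N → ℝ := Function.extend f w 0
  have hext : ∀ j, v (f j) = w j := fun j => f.injective.extend_apply w _ j
  have h0 : ∀ j : Fin N, j ∉ Set.range f → v j = 0 := fun j hj =>
    Function.extend_apply' w _ j (by simpa using hj)
  have hker : A.mulVec v = 0 := by
    ext i
    rw [← hAw]
    refine (Fintype.sum_of_injective f f.injective _ _ (fun j hj => ?_) fun j => ?_).symm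
    · rw [h0 j hj, mul_zero]
    · rw [hext]; rfl
  have hne : v ≠ 0 := by
    intro h
    exact hw (funext fun j => by rw [← hext j, h]; rfl)
  have hsupp : {i | v i ≠ 0} ⊆ Set.range f := fun i hi => by
    by_contra hi'
    exact hi (h0 i hi')
  have h1 := hA _ hker hne
  have h2 := Set.ncard_le_ncard hsupp (Set.toFinite _)
  have h3 : (Set.range f).ncard = n := by
    rw [← Set.image_univ, Set.ncard_image_of_injective _ f.injective]
    simp
  omega

/-- A subspace cut out by fewer than `N` equations contains a nonzero vector. -/
lemma exists_mulVec_eq_zero_of_vanishing {n N : ℕ} (A : Matrix (Fin n) (Fin N) ℝ)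
    (Z : Finset (Fin N)) (h : n + Z.card < N) :
    ∃ v : Fin N → ℝ, v ≠ 0 ∧ A.mulVec v = 0 ∧ ∀ i ∈ Z, v i = 0 := by
  let f : (Fin N → ℝ) →ₗ[ℝ] (Fin n → ℝ) × (Z → ℝ) :=
    A.mulVecLin.prod (LinearMap.funLeft ℝ ℝ Subtype.val)
  have hf : LinearMap.ker f ≠ ⊥ := LinearMap.ker_ne_bot_of_finrank_lt (by simpa using h)
  obtain ⟨v, hv, hv0⟩ := (Submodule.ne_bot_iff _).1 hf
  have hv' : A.mulVec v = 0 ∧ (fun i : Z => v i) = 0 := by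
    simpa [f, Prod.ext_iff, LinearMap.funLeft, Function.comp_def] using hv
  exact ⟨v, hv0, hv'.1, fun i hi => congrFun hv'.2 ⟨i, hi⟩⟩

open Classical in
lemma card_orthants_met_le {n N : ℕ} {A : Matrix (Fin n) (Fin N) ℝ}
    (hA : A ∈ genericKernel n N) (S : Finset (Fin N)) :
    (S.powerset.filter fun t => A ∈ kernelMeetsOrthant n S t).card ≤
      ∑ l ∈ Finset.range (N - n + 1), S.card.choose l := by
  refine Finset.card_le_sum_choose_of_shatters (Finset.filter_subset _ _) fun U hUS hU => ?_
  by_contra! hcard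
  have hUN : U.card + Uᶜ.card = N := by simp
  obtain ⟨y, hy, hyU⟩ : ∃ y : Fin n → ℝ, y ≠ 0 ∧ ∀ j ∈ Uᶜ, A.vecMul y j = 0 := by
    let f : (Fin n → ℝ) →ₗ[ℝ] (↥Uᶜ → ℝ) :=
      (LinearMap.funLeft ℝ ℝ Subtype.val).comp A.vecMulLinear
    have hf : LinearMap.ker f ≠ ⊥ := LinearMap.ker_ne_bot_of_finrank_lt (by
      rw [Module.finrank_fintype_fun_eq_card, Module.finrank_fintype_fun_eq_card,
        Fintype.card_coe, Fintype.card_fin]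
      omega)
    obtain ⟨y, hy, hy0⟩ := (Submodule.ne_bot_iff _).1 hf
    exact ⟨y, hy0, fun j hj => congrFun (LinearMap.mem_ker.1 hy) ⟨j, hj⟩⟩
  obtain ⟨t, ht, hUt⟩ := hU (Finset.filter_subset (fun j => 0 ≤ A.vecMul y j) U)
  obtain ⟨v, hv, hAv, hsign⟩ := (Finset.mem_filter.1 ht).2
  have hnonneg : ∀ j, 0 ≤ A.vecMul y j * v j := by
    intro j
    by_cases hj : j ∈ U
    · have hiff : j ∈ t ↔ 0 ≤ A.vecMul y j := by
        simpa [hj] using Finset.ext_iff.1 hUt j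
      by_cases hjt : j ∈ t
      · exact mul_nonneg (hiff.1 hjt) ((hsign j (hUS hj)).1 hjt)
      · exact mul_nonneg_of_nonpos_of_nonpos (not_le.1 (mt hiff.2 hjt)).le
          ((hsign j (hUS hj)).2 hjt)
    · rw [hyU j (Finset.mem_compl.2 hj), zero_mul]
  have hsum : ∑ j, A.vecMul y j * v j = 0 := by
    change A.vecMul y ⬝ᵥ v = 0
    rw [← Matrix.dotProduct_mulVec, hAv, dotProduct_zero]
  have hzero := (Finset.sum_eq_zero_iff_of_nonneg fun j _ => hnonneg j).1 hsum
  have hsub : {j | v j ≠ 0} ⊆ {j | A.vecMul y j = 0} := fun j hj =>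
    (mul_eq_zero.1 (hzero j (Finset.mem_univ j))).resolve_right hj
  have h1 := hA v hAv hv
  have h2 := Set.ncard_le_ncard hsub (Set.toFinite _)
  have h3 := card_vecMul_eq_zero_lt hA hy
  omega

open Classical in
lemma card_orthants_missed_le {n N : ℕ} (A : Matrix (Fin n) (Fin N) ℝ) {k : ℕ}
    (S : Finset (Fin N)) (hS : S.card + k = N) :
    (S.powerset.filter fun t => A ∉ kernelMeetsOrthant n S t).card ≤
      ∑ l ∈ Finset.range (n - k + 1), S.card.choose l := by
  refine Finset.card_le_sum_choose_of_shatters (Finset.filter_subset _ _) fun U hUS hU => ?_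
  by_contra! hcard
  have hdiff := Finset.card_sdiff_add_card_eq_card hUS
  obtain ⟨v, hv, hAv, hvZ⟩ := exists_mulVec_eq_zero_of_vanishing A (S \ U) (by omega)
  obtain ⟨t, ht, hUt⟩ := hU (Finset.filter_subset (fun j => 0 ≤ v j) U)
  refine (Finset.mem_filter.1 ht).2 ⟨v, hv, hAv, fun j hj => ?_⟩
  by_cases hjU : j ∈ U
  · have hiff : j ∈ t ↔ 0 ≤ v j := by simpa [hjU] using Finset.ext_iff.1 hUt j
    exact ⟨hiff.1, fun h => (not_le.1 (mt hiff.2 h)).le⟩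
  · have := hvZ j (Finset.mem_sdiff.2 ⟨hj, hjU⟩)
    exact ⟨fun _ => this.ge, fun _ => this.le⟩

instance matrixBorelSpace {n N : ℕ} : BorelSpace (Matrix (Fin n) (Fin N) ℝ) :=
  (inferInstance : BorelSpace (Fin n → Fin N → ℝ))

lemma isClosed_exists_kernel_mem_cone {n N : ℕ} {C : Set (Fin N → ℝ)} (hC : IsClosed C)
    (hcone : ∀ c : ℝ, 0 < c → ∀ v ∈ C, c • v ∈ C) :
    IsClosed {A : Matrix (Fin n) (Fin N) ℝ | ∃ v, v ≠ 0 ∧ A.mulVec v = 0 ∧ v ∈ C} := by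
  let F : Set (Matrix (Fin n) (Fin N) ℝ × Metric.sphere (0 : Fin N → ℝ) 1) :=
    {p | p.1.mulVec p.2 = 0 ∧ (p.2 : Fin N → ℝ) ∈ C}
  have hF : IsClosed F := by
    refine IsClosed.inter (isClosed_eq ?_ continuous_const)
      (hC.preimage (continuous_subtype_val.comp continuous_snd))
    exact continuous_fst.matrix_mulVec (continuous_subtype_val.comp continuous_snd)
  convert isClosedMap_fst_of_compactSpace F hF using 1
  ext A
  constructor
  · rintro ⟨v, hv, hAv, hvC⟩
    have hpos : 0 < ‖v‖ := norm_pos_iff.2 hv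
    refine ⟨(A, ⟨‖v‖⁻¹ • v, ?_⟩), ⟨?_, hcone _ (inv_pos.2 hpos) v hvC⟩, rfl⟩
    · simp [norm_smul, hpos.ne']
    · simp [Matrix.mulVec_smul, hAv]
  · rintro ⟨⟨B, v⟩, ⟨hBv, hvC⟩, rfl⟩
    exact ⟨v, ne_zero_of_mem_unit_sphere v, hBv, hvC⟩

lemma measurableSet_kernelMeetsOrthant {n N : ℕ} (S t : Finset (Fin N)) :
    MeasurableSet (kernelMeetsOrthant n S t) := by
  refine (isClosed_exists_kernel_mem_cone
    (C := {v : Fin N → ℝ | ∀ i ∈ S, (i ∈ t → 0 ≤ v i) ∧ (i ∉ t → v i ≤ 0)}) ?_ ?_).measurableSet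
  · simp only [Set.ofPred_forall, Set.ofPred_and]
    exact isClosed_iInter fun i => isClosed_iInter fun _ =>
      (isClosed_iInter fun _ => isClosed_le continuous_const (continuous_apply i)).inter
        (isClosed_iInter fun _ => isClosed_le (continuous_apply i) continuous_const)
  · intro c hc v hv i hi
    exact ⟨fun h => mul_nonneg hc.le ((hv i hi).1 h),
      fun h => mul_nonpos_of_nonneg_of_nonpos hc.le ((hv i hi).2 h)⟩

lemma measurableSet_genericKernel (n N : ℕ) : MeasurableSet (genericKernel n N) := by
  have hcompl : (genericKernel n N)ᶜ = ⋃ T : Finset (Fin N), ⋃ _ : T.card ≤ n,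
      {A | ∃ v : Fin N → ℝ, v ≠ 0 ∧ A.mulVec v = 0 ∧ v ∈ {v | ∀ i, i ∉ T → v i = 0}} := by
    ext A
    simp only [genericKernel, Set.mem_compl_iff, Set.mem_ofPred_eq, Set.mem_iUnion]
    push Not
    constructor
    · rintro ⟨v, hAv, hv, hcard⟩
      refine ⟨Finset.univ.filter fun i => v i ≠ 0, ?_, v, hv, hAv, by simp⟩
      rw [Set.ncard_eq_toFinset_card', Set.toFinset_ofPred] at hcard
      exact Nat.lt_succ_iff.1 hcard
    · rintro ⟨T, hT, v, hv, hAv, hvT⟩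
      refine ⟨v, hAv, hv, Nat.lt_succ_of_le (le_trans ?_ hT)⟩
      rw [← Set.ncard_coe_finset]
      refine Set.ncard_le_ncard (fun i hi => ?_) T.finite_toSet
      by_contra hiT
      exact hi (hvT i hiT)
  rw [← MeasurableSet.compl_iff, hcompl]
  refine MeasurableSet.iUnion fun T => MeasurableSet.iUnion fun _ =>
    (isClosed_exists_kernel_mem_cone ?_ ?_).measurableSet
  · simp only [Set.ofPred_forall]
    exact isClosed_iInter fun i => isClosed_iInter fun _ =>
      isClosed_eq (continuous_apply i) continuous_const
  · intro c _ v hv i hi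
    simp [hv i hi]

lemma OrthantSymmetricGeneric.ae_mem_genericKernel {n N : ℕ}
    {μ : Measure (Matrix (Fin n) (Fin N) ℝ)} [IsProbabilityMeasure μ]
    (hμ : OrthantSymmetricGeneric μ) : ∀ᵐ A ∂μ, A ∈ genericKernel n N := by
  rw [ae_iff]
  refine (prob_compl_eq_zero_iff (measurableSet_genericKernel n N)).2 (le_antisymm prob_le_one ?_)
  exact hμ.2.ge.trans (measure_mono fun A hA => hA.2)

/-- Every orthant is met by the random kernel with the same probability. -/
lemma OrthantSymmetricGeneric.measure_kernelMeetsOrthant {n N : ℕ}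
    {μ : Measure (Matrix (Fin n) (Fin N) ℝ)} (hμ : OrthantSymmetricGeneric μ)
    (S t u : Finset (Fin N)) :
    μ (kernelMeetsOrthant n S t) = μ (kernelMeetsOrthant n S u) := by
  classical
  let s : Fin N → ℝ := fun i => if (i ∈ t ↔ i ∈ u) then 1 else -1
  have hs : ∀ i, s i = 1 ∨ s i = -1 := fun i => ite_eq_or_eq _ _ _
  have hss : ∀ i, s i * s i = 1 := fun i => by rcases hs i with h | h <;> simp [h]
  have hmeas : Measurable fun A : Matrix (Fin n) (Fin N) ℝ => A * Matrix.diagonal s :=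
    (continuous_id.matrix_mul continuous_const).measurable
  have hflip : ∀ {t u : Finset (Fin N)}, (∀ i, s i = if (i ∈ t ↔ i ∈ u) then 1 else -1) →
      ∀ {A B : Matrix (Fin n) (Fin N) ℝ}, (∀ v, A.mulVec (s * v) = B.mulVec v) →
        B ∈ kernelMeetsOrthant n S t → A ∈ kernelMeetsOrthant n S u := by
    rintro t u hsi A B hAB ⟨v, hv, hBv, hsign⟩
    refine ⟨s * v, fun h => hv ?_, by rw [hAB, hBv], fun i hi => ?_⟩
    · ext i
      have : s i * v i = 0 := congrFun h i
      calc v i = s i * (s i * v i) := by rw [← mul_assoc, hss, one_mul]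
        _ = 0 := by rw [this, mul_zero]
    · have := hsign i hi
      simp only [Pi.mul_apply, hsi]
      by_cases h1 : i ∈ t <;> by_cases h2 : i ∈ u <;> simp_all
  have hmul : ∀ (A : Matrix (Fin n) (Fin N) ℝ) (v : Fin N → ℝ),
      (A * Matrix.diagonal s).mulVec v = A.mulVec (s * v) := by
    intro A v
    rw [← Matrix.mulVec_mulVec]
    congr 1
    ext i
    simp [Matrix.mulVec_diagonal]
  conv_rhs => rw [← hμ.1 s hs]
  rw [Measure.map_apply hmeas (measurableSet_kernelMeetsOrthant S u)]
  congr 1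
  ext A
  refine ⟨hflip (fun i => rfl) fun v => ?_, hflip (fun i => ?_) fun v => (hmul A v).symm⟩
  · rw [hmul]
    congr 1
    ext i
    simp [← mul_assoc, hss]
  · simp only [s, iff_comm]

open Classical in
/-- If equiprobable events almost surely do not occur more than `b` at a time, their common
probability is at most `b` over the number of events. -/
lemma card_mul_measureReal_le {Ω ι : Type*} [MeasurableSpace Ω] {μ : Measure Ω}
    [IsProbabilityMeasure μ] {P : Finset ι} {E : ι → Set Ω} (hE : ∀ t, MeasurableSet (E t))
    {c : ℝ} (hc : ∀ t ∈ P, μ.real (E t) = c) {b : ℕ}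
    (hb : ∀ᵐ ω ∂μ, (P.filter fun t => ω ∈ E t).card ≤ b) : P.card * c ≤ b := by
  calc (P.card : ℝ) * c = ∑ t ∈ P, μ.real (E t) := by
        rw [Finset.sum_congr rfl hc, Finset.sum_const, nsmul_eq_mul]
    _ = ∑ t ∈ P, ∫ ω, (E t).indicator 1 ω ∂μ := by simp only [integral_indicator_one (hE _)]
    _ = ∫ ω, ∑ t ∈ P, (E t).indicator 1 ω ∂μ :=
        (integral_finsetSum _ fun t _ => (integrable_const (1 : ℝ)).indicator (hE t)).symm
    _ ≤ ∫ _, (b : ℝ) ∂μ := by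
        refine integral_mono_ae (integrable_finsetSum _ fun t _ =>
          (integrable_const (1 : ℝ)).indicator (hE t)) (integrable_const _) ?_
        filter_upwards [hb] with ω hω
        simpa [Set.indicator_apply, Finset.sum_boole] using hω
    _ = b := by simp

/-- The probability that a fair binomial variable of size `M` is at most `m`. -/
noncomputable def fairBinomialTail (M m : ℕ) : ℝ :=
  (∑ l ∈ Finset.range (m + 1), M.choose l : ℕ) / 2 ^ M

lemma sum_choose_mul_sq (M : ℕ) :
    ∑ l ∈ Finset.range (M + 1), ((M : ℝ) / 2 - l) ^ 2 * (M.choose l : ℝ) =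
      (2 : ℝ) ^ M * ((M : ℝ) / 4) := by
  have h := congrArg (Polynomial.eval (1 / 2 : ℝ)) (bernsteinPolynomial.variance ℝ M)
  simp only [Polynomial.eval_finsetSum, bernsteinPolynomial, Polynomial.eval_mul,
    Polynomial.eval_pow, Polynomial.eval_sub, Polynomial.eval_X,
    Polynomial.eval_natCast, Polynomial.eval_one, nsmul_eq_mul] at h
  calc _ = 2 ^ M * ∑ l ∈ Finset.range (M + 1), ((M : ℝ) * (1 / 2) - l) ^ 2 *
        (M.choose l * (1 / 2) ^ l * (1 - 1 / 2) ^ (M - l)) := by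
        rw [Finset.mul_sum]
        refine Finset.sum_congr rfl fun l hl => ?_
        have hlM : l + (M - l) = M := Nat.add_sub_of_le (Nat.lt_succ_iff.1 (Finset.mem_range.1 hl))
        have hpow : (2 : ℝ) ^ M * ((1 / 2) ^ l * (1 - 1 / 2) ^ (M - l)) = 1 := by
          rw [show (1 : ℝ) - 1 / 2 = 1 / 2 by norm_num, ← pow_add, hlM, ← mul_pow]
          norm_num
        linear_combination (-((M : ℝ) / 2 - l) ^ 2 * M.choose l) * hpow
    _ = _ := by rw [h]; ring

/-- Chebyshev's inequality for the fair binomial distribution. -/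
lemma fairBinomialTail_le {M m : ℕ} (hm : (m : ℝ) < M / 2) :
    fairBinomialTail M m ≤ M / 4 / (M / 2 - m) ^ 2 := by
  have hpos : 0 < ((M : ℝ) / 2 - m) ^ 2 := pow_pos (sub_pos.2 hm) 2
  have hmM : m ≤ M := by
    have : (m : ℝ) ≤ M := by have := Nat.cast_nonneg (α := ℝ) M; linarith
    exact_mod_cast this
  rw [fairBinomialTail, div_le_div_iff₀ (by positivity) hpos, mul_comm (_ / 4 : ℝ),
    ← sum_choose_mul_sq, Nat.cast_sum, Finset.sum_mul]
  refine (Finset.sum_le_sum fun l hl => ?_).trans (Finset.sum_le_sum_of_subset_of_nonneg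
    (Finset.range_mono (Nat.succ_le_succ hmM)) fun l _ _ => by positivity)
  have hl' : (l : ℝ) ≤ m := by exact_mod_cast Nat.lt_succ_iff.1 (Finset.mem_range.1 hl)
  rw [mul_comm]
  gcongr

lemma tendsto_fairBinomialTail {M m : ℕ → ℕ} {a : ℝ} (ha : a < 1 / 2)
    (hM : Tendsto M atTop atTop) (hm : Tendsto (fun n => (m n : ℝ) / M n) atTop (nhds a)) :
    Tendsto (fun n => fairBinomialTail (M n) (m n)) atTop (nhds 0) := by
  have hlim : Tendsto (fun n => (M n : ℝ)⁻¹ * (1 / 4 / (1 / 2 - (m n : ℝ) / M n) ^ 2)) atTop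
      (nhds (0 * (1 / 4 / (1 / 2 - a) ^ 2))) := by
    refine (tendsto_inv_atTop_zero.comp (tendsto_natCast_atTop_atTop.comp hM)).mul
      (tendsto_const_nhds.div ((tendsto_const_nhds.sub hm).pow 2) ?_)
    exact (pow_pos (sub_pos.2 ha) 2).ne'
  rw [zero_mul] at hlim
  refine squeeze_zero' (Eventually.of_forall fun n => by unfold fairBinomialTail; positivity)
    ?_ hlim
  filter_upwards [hm.eventually_lt_const ha, hM.eventually_gt_atTop 0] with n h1 h2
  have hMpos : (0 : ℝ) < M n := by exact_mod_cast h2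
  have h3 : (m n : ℝ) < M n / 2 := by
    rw [div_lt_iff₀ hMpos] at h1
    linarith
  refine (fairBinomialTail_le h3).trans_eq ?_
  have h4 : (M n : ℝ) / 2 - m n = M n * (1 / 2 - m n / M n) := by field_simp
  have h5 : (1 : ℝ) / 2 - m n / M n ≠ 0 := (sub_pos.2 h1).ne'
  rw [h4, mul_pow]
  generalize (1 : ℝ) / 2 - m n / M n = z at h5
  field_simp

open Classical in
/-- Uniqueness in the unit cube is a condition on the signs of kernel vectors on the active
constraints. -/
lemma forall_mem_cube_iff_notMem_kernelMeetsOrthant {n N : ℕ} (A : Matrix (Fin n) (Fin N) ℝ)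
    {x : Fin N → ℝ} (hx : ∀ i, 0 ≤ x i ∧ x i ≤ 1) :
    (∀ z : Fin N → ℝ, (∀ i, 0 ≤ z i ∧ z i ≤ 1) → A.mulVec z = A.mulVec x → z = x) ↔
      A ∉ kernelMeetsOrthant n (Finset.univ.filter fun i => ¬(0 < x i ∧ x i < 1))
        (Finset.univ.filter fun i => x i = 0) := by
  constructor
  · rintro h ⟨v, hv, hAv, hsign⟩
    have hcont : ∀ i, Tendsto (fun ε : ℝ => x i + ε * v i) (nhdsWithin 0 (Set.Ioi 0))
        (nhds (x i)) := by
      intro i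
      have : Continuous fun ε : ℝ => x i + ε * v i := by fun_prop
      simpa using (this.tendsto 0).mono_left nhdsWithin_le_nhds
    have hev : ∀ i, ∀ᶠ ε in nhdsWithin (0 : ℝ) (Set.Ioi 0),
        0 ≤ x i + ε * v i ∧ x i + ε * v i ≤ 1 := by
      intro i
      refine Eventually.and ?_ ?_
      · rcases (hx i).1.lt_or_eq with h0 | h0
        · exact ((hcont i).eventually_const_lt h0).mono fun _ => le_of_lt
        · filter_upwards [self_mem_nhdsWithin] with ε hε
          have hvi : 0 ≤ v i := (hsign i (by simp [← h0])).1 (by simp [← h0])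
          exact add_nonneg (hx i).1 (mul_nonneg (Set.mem_Ioi.1 hε).le hvi)
      · rcases (hx i).2.lt_or_eq with h1 | h1
        · exact ((hcont i).eventually_lt_const h1).mono fun _ => le_of_lt
        · filter_upwards [self_mem_nhdsWithin] with ε hε
          have hvi : v i ≤ 0 := (hsign i (by simp [h1])).2 (by simp [h1])
          have := mul_nonpos_of_nonneg_of_nonpos (Set.mem_Ioi.1 hε).le hvi
          linarith
    obtain ⟨ε, hε, hε0⟩ := ((eventually_all.2 hev).and self_mem_nhdsWithin).exists
    have heq := h (x + ε • v) hε (by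
      rw [Matrix.mulVec_add, Matrix.mulVec_smul, hAv, smul_zero, add_zero])
    exact smul_ne_zero (Set.mem_Ioi.1 hε0 : (0 : ℝ) < ε).ne' hv (left_eq_add.1 heq.symm)
  · intro h z hz hAz
    by_contra hne
    refine h ⟨z - x, sub_ne_zero.2 hne, by rw [Matrix.mulVec_sub, hAz, sub_self],
      fun i hi => ⟨fun h0 => ?_, fun h0 => ?_⟩⟩
    · have h0' : x i = 0 := by simpa using h0
      simpa [h0'] using (hz i).1
    · have h0' : x i ≠ 0 := by simpa using h0
      have hlt : 0 < x i := lt_of_le_of_ne (hx i).1 h0'.symm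
      have h1 : x i = 1 := le_antisymm (hx i).2 (by
        by_contra! hlt1
        exact (Finset.mem_filter.1 hi).2 ⟨hlt, hlt1⟩)
      simpa [h1] using (hz i).2

/-- Nonasymptotic form of the threshold: the probabilities of uniqueness and of its failure are
both bounded by tails of the fair binomial distribution of size `N - k`. -/
lemma OrthantSymmetricGeneric.cube_uniqueness_bounds {n N k : ℕ}
    {μ : Measure (Matrix (Fin n) (Fin N) ℝ)} [IsProbabilityMeasure μ]
    (hμ : OrthantSymmetricGeneric μ) {x : Fin N → ℝ} (hx : ∀ i, 0 ≤ x i ∧ x i ≤ 1)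
    (hk : {i | 0 < x i ∧ x i < 1}.ncard = k) :
    1 - fairBinomialTail (N - k) (N - n) ≤ μ.real {A | ∀ z : Fin N → ℝ,
        (∀ i, 0 ≤ z i ∧ z i ≤ 1) → A.mulVec z = A.mulVec x → z = x} ∧
      μ.real {A | ∀ z : Fin N → ℝ,
        (∀ i, 0 ≤ z i ∧ z i ≤ 1) → A.mulVec z = A.mulVec x → z = x} ≤
          fairBinomialTail (N - k) (n - k) := by
  classical
  set S : Finset (Fin N) := Finset.univ.filter fun i => ¬(0 < x i ∧ x i < 1)
  set t₀ : Finset (Fin N) := Finset.univ.filter fun i => x i = 0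
  have hS : S.card + k = N := by
    rw [← hk, Set.ncard_eq_toFinset_card', Set.toFinset_ofPred, add_comm,
      Finset.card_filter_add_card_filter_not]
    simp
  have hSk : N - k = S.card := by omega
  have hset : {A : Matrix (Fin n) (Fin N) ℝ | ∀ z : Fin N → ℝ,
      (∀ i, 0 ≤ z i ∧ z i ≤ 1) → A.mulVec z = A.mulVec x → z = x} =
      (kernelMeetsOrthant n S t₀)ᶜ :=
    Set.ext fun A => forall_mem_cube_iff_notMem_kernelMeetsOrthant A hx
  have hE := fun t => measurableSet_kernelMeetsOrthant (n := n) S t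
  have hsymm : ∀ t, μ.real (kernelMeetsOrthant n S t) = μ.real (kernelMeetsOrthant n S t₀) :=
    fun t => congrArg ENNReal.toReal (hμ.measure_kernelMeetsOrthant S t t₀)
  have hmet := card_mul_measureReal_le hE (P := S.powerset) (fun t _ => hsymm t)
    (hμ.ae_mem_genericKernel.mono fun A hA => card_orthants_met_le hA S)
  have hmissed := card_mul_measureReal_le (μ := μ) (fun t => (hE t).compl) (P := S.powerset)
    (c := μ.real (kernelMeetsOrthant n S t₀)ᶜ)
    (fun t _ => by rw [probReal_compl_eq_one_sub (hE t), probReal_compl_eq_one_sub (hE t₀), hsymm])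
    (b := ∑ l ∈ Finset.range (n - k + 1), S.card.choose l)
    (ae_of_all _ fun A => by simpa using card_orthants_missed_le A S hS)
  rw [Finset.card_powerset, Nat.cast_pow, Nat.cast_two, mul_comm] at hmet hmissed
  rw [hset, hSk]
  refine ⟨?_, (le_div_iff₀ (by positivity)).2 hmissed⟩
  rw [probReal_compl_eq_one_sub (hE t₀)]
  exact sub_le_sub_left ((le_div_iff₀ (by positivity)).2 hmet) 1

/-- **Weak threshold for the hypercube (probabilistic form).** Let `p_n` be the
probability that a fixed vector in `[0,1]^{N_n}` with exactly `k_n` entries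
strictly between `0` and `1` is the unique solution in the hypercube of the
corresponding underdetermined system. Then `p_n → 1` if `ρ < 2 - δ⁻¹`, and
`p_n → 0` if `ρ > max 0 (2 - δ⁻¹)`. -/
theorem weak_threshold_hypercube (δ ρ : ℝ)
    (hδ0 : 0 < δ) (hδ1 : δ < 1) (hρ0 : 0 < ρ) (hρ1 : ρ < 1)
    (k Nn : ℕ → ℕ)
    (hseq : ∀ n : ℕ, 1 ≤ n → k n < n ∧ n < Nn n)
    (hk : Tendsto (fun n : ℕ => (k n : ℝ) / n) atTop (nhds ρ))
    (hN : Tendsto (fun n : ℕ => (n : ℝ) / Nn n) atTop (nhds δ))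
    (μ : (n : ℕ) → Measure (Matrix (Fin n) (Fin (Nn n)) ℝ))
    [∀ n, IsProbabilityMeasure (μ n)]
    (hμ : ∀ n : ℕ, 1 ≤ n → OrthantSymmetricGeneric (μ n))
    (x0 : (n : ℕ) → Fin (Nn n) → ℝ)
    (hx0 : ∀ n : ℕ, 1 ≤ n →
      (∀ i, 0 ≤ x0 n i ∧ x0 n i ≤ 1) ∧
        {i | 0 < x0 n i ∧ x0 n i < 1}.ncard = k n) :
    (ρ < 2 - δ⁻¹ →
      Tendsto (fun n : ℕ =>
          (μ n {A | ∀ x : Fin (Nn n) → ℝ, (∀ i, 0 ≤ x i ∧ x i ≤ 1) →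
            A.mulVec x = A.mulVec (x0 n) → x = x0 n}).toReal)
        atTop (nhds 1)) ∧
    (max 0 (2 - δ⁻¹) < ρ →
      Tendsto (fun n : ℕ =>
          (μ n {A | ∀ x : Fin (Nn n) → ℝ, (∀ i, 0 ≤ x i ∧ x i ≤ 1) →
            A.mulVec x = A.mulVec (x0 n) → x = x0 n}).toReal)
        atTop (nhds 0)) := by
  have hNn : Tendsto (fun n : ℕ => (Nn n : ℝ) / n) atTop (nhds δ⁻¹) :=
    (hN.inv₀ hδ0.ne').congr fun n => inv_div _ _
  have hgap : 0 < δ⁻¹ - ρ := sub_pos.2 (hρ1.trans ((one_lt_inv₀ hδ0).2 hδ1))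
  have hMn : Tendsto (fun n : ℕ => ((Nn n - k n : ℕ) : ℝ) / n) atTop (nhds (δ⁻¹ - ρ)) := by
    refine (hNn.sub hk).congr' ?_
    filter_upwards [eventually_ge_atTop 1] with n hn
    rw [Nat.cast_sub ((hseq n hn).1.trans (hseq n hn).2).le, sub_div]
  have hM : Tendsto (fun n => Nn n - k n) atTop atTop := by
    rw [← tendsto_natCast_atTop_iff (R := ℝ)]
    refine (hMn.pos_mul_atTop hgap tendsto_natCast_atTop_atTop).congr' ?_
    filter_upwards [eventually_ge_atTop 1] with n hn
    have : (n : ℝ) ≠ 0 := by positivity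
    field_simp
  have hratio : ∀ {m : ℕ → ℕ} {c : ℝ}, Tendsto (fun n => (m n : ℝ) / n) atTop (nhds c) →
      Tendsto (fun n => (m n : ℝ) / (Nn n - k n : ℕ)) atTop (nhds (c / (δ⁻¹ - ρ))) := by
    intro m c hm
    refine (hm.div hMn hgap.ne').congr' ?_
    filter_upwards [eventually_ge_atTop 1] with n hn
    exact div_div_div_cancel_right₀ (by positivity) _ _
  have hbounds := fun n hn => (hμ n hn).cube_uniqueness_bounds (hx0 n hn).1 (hx0 n hn).2
  constructor
  · intro hρ
    have hm : Tendsto (fun n : ℕ => ((Nn n - n : ℕ) : ℝ) / n) atTop (nhds (δ⁻¹ - 1)) := by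
      refine (hNn.sub_const 1).congr' ?_
      filter_upwards [eventually_ge_atTop 1] with n hn
      have : (n : ℝ) ≠ 0 := by positivity
      rw [Nat.cast_sub (hseq n hn).2.le, sub_div, div_self this]
    have htail := tendsto_fairBinomialTail
      ((div_lt_iff₀ hgap).2 (by linarith)) hM (hratio hm)
    refine tendsto_of_tendsto_of_tendsto_of_le_of_le' (by simpa using htail.const_sub 1)
      tendsto_const_nhds ?_ (Eventually.of_forall fun n => measureReal_le_one)
    filter_upwards [eventually_ge_atTop 1] with n hn using (hbounds n hn).1
  · intro hρ
    have hm : Tendsto (fun n : ℕ => ((n - k n : ℕ) : ℝ) / n) atTop (nhds (1 - ρ)) := by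
      refine (hk.const_sub 1).congr' ?_
      filter_upwards [eventually_ge_atTop 1] with n hn
      have : (n : ℝ) ≠ 0 := by positivity
      rw [Nat.cast_sub (hseq n hn).1.le, sub_div, div_self this]
    have hρ' := (le_max_right _ _).trans_lt hρ
    have htail := tendsto_fairBinomialTail
      ((div_lt_iff₀ hgap).2 (by linarith)) hM (hratio hm)
    refine squeeze_zero' (Eventually.of_forall fun n => ENNReal.toReal_nonneg) ?_ htail
    filter_upwards [eventually_ge_atTop 1] with n hn using (hbounds n hn).2
end
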